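/- Lower bound on the closest reachable point on the +x-axis when l − r ≡ 1 (mod 4): Let σ be a turn sequence with l L's and r R's, l − r ≥ 0 and l − r ≡ 1 (mod 4), and let C be any chain realizing σ whose endpoint is p = (a, 0) with a > 0. If σ₁ = L, then a ≥ |⌊(l − r + 2)/4⌋ − 1| + 2. If σ₁ = R, then a ≥ min{₊ₓm₋ᵧᵒ(C), ₊ₓm₊ᵧᵖ(C)} + ⌊(l − r + 2)/4⌋ + 1. -/

import Mathlib

/-- A turn: left (`L`) or right (`R`). -/
inductive Turn : Type
  | L : Turn
  | R : Turn
  deriving DecidableEq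

/-- Rotation of a direction vector by 90° counterclockwise. -/
def rotCCW (d : ℤ × ℤ) : ℤ × ℤ := (-d.2, d.1)

/-- Rotation of a direction vector by 90° clockwise. -/
def rotCW (d : ℤ × ℤ) : ℤ × ℤ := (d.2, -d.1)

/-- Unit direction of the axis-parallel segment from `u` to `v`. -/
def unitDir (u v : ℤ × ℤ) : ℤ × ℤ := ((v.1 - u.1).sign, (v.2 - u.2).sign)

/-- The set of integer points on the axis-parallel closed segment from `u` to `v`. -/
def segSet (u v : ℤ × ℤ) : Set (ℤ × ℤ) :=
  {q | min u.1 v.1 ≤ q.1 ∧ q.1 ≤ max u.1 v.1 ∧ min u.2 v.2 ≤ q.2 ∧ q.2 ≤ max u.2 v.2}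

/-- A simple rectilinear chain realizing the turn sequence `σ = σ₁⋯σₙ` (as a list,
`σ.get ⟨i, _⟩` is the `(i+1)`-st turn `σ_{i+1}`).  It consists of the points
`pts 0, …, pts (n+1)` with `pts 0 = (0,0)`; consecutive points span nondegenerate
axis-parallel segments, the first segment heads east, the chain turns left (CCW) or
right (CW) at each bend as prescribed by `σ`, and the chain is simple. -/
structure Chain (σ : List Turn) where
  pts : ℕ → ℤ × ℤ
  start_eq : pts 0 = (0, 0)
  first_seg : ∃ t : ℤ, 0 < t ∧ pts 1 = (t, 0)
  axis_parallel : ∀ i ≤ σ.length,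
    ((pts (i + 1)).1 = (pts i).1 ∧ (pts (i + 1)).2 ≠ (pts i).2) ∨
    ((pts (i + 1)).2 = (pts i).2 ∧ (pts (i + 1)).1 ≠ (pts i).1)
  turns : ∀ i, ∀ h : i < σ.length,
    unitDir (pts (i + 1)) (pts (i + 2)) =
      (if σ.get ⟨i, h⟩ = Turn.L then rotCCW else rotCW) (unitDir (pts i) (pts (i + 1)))
  simple_adj : ∀ i, i + 1 ≤ σ.length →
    segSet (pts i) (pts (i + 1)) ∩ segSet (pts (i + 1)) (pts (i + 2)) = {pts (i + 1)}
  simple_nonadj : ∀ i j, i + 1 < j → j ≤ σ.length →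
    segSet (pts i) (pts (i + 1)) ∩ segSet (pts j) (pts (j + 1)) = ∅

/-- `A(σ)`: the set of points reachable by the turn sequence `σ`. -/
def ReachSet (σ : List Turn) : Set (ℤ × ℤ) :=
  {q | ∃ C : Chain σ, C.pts (σ.length + 1) = q}

/-- The halfplane `V⁺(p)` (requires `p.1 ≠ 0` to be meaningful). -/
def Vplus (p : ℤ × ℤ) : Set (ℤ × ℤ) :=
  {q | ∃ i j : ℤ, 0 ≤ i ∧ q = (p.1 + p.1.sign * i, j)}

/-- The halfplane `H⁺(p)` (requires `p.2 ≠ 0` to be meaningful). -/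
def Hplus (p : ℤ × ℤ) : Set (ℤ × ℤ) :=
  {q | ∃ i j : ℤ, 0 ≤ j ∧ q = (i, p.2 + p.2.sign * j)}

/-- The quadrant `Q⁺(p)`. -/
def Qplus (p : ℤ × ℤ) : Set (ℤ × ℤ) := Vplus p ∩ Hplus p

/-- A staircase: consecutive turns always differ. -/
def IsStaircase (σ : List Turn) : Prop := σ.Chain' (· ≠ ·)

/-- The prefix number `δᵢ`: number of `L`s minus number of `R`s among the first `i` turns. -/
def delta (σ : List Turn) (i : ℕ) : ℤ :=
  ((σ.take i).count Turn.L : ℤ) - ((σ.take i).count Turn.R : ℤ)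

/-- The excess number `l - r` of a turn sequence. -/
def excess (σ : List Turn) : ℤ := (σ.count Turn.L : ℤ) - (σ.count Turn.R : ℤ)

/-- `σ` has a hook (two equal consecutive turns, at 1-based positions `k+1, k+2`)
whose prefix number is `≡ d (mod 4)`: `d = 0, 1, 2, 3` for right, up, left, down hooks. -/
def HasHook (σ : List Turn) (d : ℤ) : Prop :=
  ∃ k, ∃ h : k + 1 < σ.length,
    σ.get ⟨k, by omega⟩ = σ.get ⟨k + 1, h⟩ ∧ delta σ (k + 1) % 4 = d

/-- `σ` has some hook, i.e. two equal consecutive turns. -/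
def HasAnyHook (σ : List Turn) : Prop :=
  ∃ k, ∃ h : k + 1 < σ.length, σ.get ⟨k, by omega⟩ = σ.get ⟨k + 1, h⟩

/-- A set `S ⊆ ℤ²` is connected: any two points of `S` are joined by a path inside `S`
whose consecutive points are at `L¹`-distance `1`. -/
def GridConnected (S : Set (ℤ × ℤ)) : Prop :=
  ∀ p ∈ S, ∀ q ∈ S, ∃ (n : ℕ) (f : ℕ → ℤ × ℤ),
    f 0 = p ∧ f n = q ∧ (∀ i ≤ n, f i ∈ S) ∧
    ∀ i < n, |(f (i + 1)).1 - (f i).1| + |(f (i + 1)).2 - (f i).2| = 1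

/-- `q` lies on the boundary of the smallest axis-parallel bounding box of the chain `C`
(for `q` a point of the chain: it attains an extreme coordinate). -/
def OnBBoxBoundary (σ : List Turn) (C : Chain σ) (q : ℤ × ℤ) : Prop :=
  (∀ i ≤ σ.length + 1, q.1 ≤ (C.pts i).1) ∨ (∀ i ≤ σ.length + 1, (C.pts i).1 ≤ q.1) ∨
  (∀ i ≤ σ.length + 1, q.2 ≤ (C.pts i).2) ∨ (∀ i ≤ σ.length + 1, (C.pts i).2 ≤ q.2)

/-- The last segment of the chain `C` is entirely contained in one side of the smallest
axis-parallel bounding box of `C`. -/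
def LastSegOnSide (σ : List Turn) (C : Chain σ) : Prop :=
  ((C.pts σ.length).1 = (C.pts (σ.length + 1)).1 ∧
     ∀ i ≤ σ.length + 1, (C.pts σ.length).1 ≤ (C.pts i).1) ∨
  ((C.pts σ.length).1 = (C.pts (σ.length + 1)).1 ∧
     ∀ i ≤ σ.length + 1, (C.pts i).1 ≤ (C.pts σ.length).1) ∨
  ((C.pts σ.length).2 = (C.pts (σ.length + 1)).2 ∧
     ∀ i ≤ σ.length + 1, (C.pts σ.length).2 ≤ (C.pts i).2) ∨
  ((C.pts σ.length).2 = (C.pts (σ.length + 1)).2 ∧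
     ∀ i ≤ σ.length + 1, (C.pts i).2 ≤ (C.pts σ.length).2)

/-- The turn `σₘ` (1-based indexing). -/
def turnAt (σ : List Turn) (m : ℕ) : Turn := σ.getD (m - 1) Turn.L

/-- The suffix `σ_k ⋯ σ_n` contains no hook and all its prefix numbers `δᵢ`,
`k - 1 ≤ i ≤ n`, are `≡ 1` or `2 (mod 4)` (the combinatorial description of a
NW-staircase containing the endpoint). -/
def GoodSuffix (σ : List Turn) (k : ℕ) : Prop :=
  1 ≤ k ∧ k ≤ σ.length ∧
  (∀ m : ℕ, k ≤ m → m < σ.length → turnAt σ m ≠ turnAt σ (m + 1)) ∧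
  (∀ i : ℕ, k - 1 ≤ i → i ≤ σ.length → delta σ i % 4 = 1 ∨ delta σ i % 4 = 2)

open Classical in
/-- `₋ₓm₊ᵧᵖ(σ)`: taking the longest good suffix (i.e. the least `k` with
`GoodSuffix σ k`), the number of indices `i` with `k - 1 ≤ i ≤ n` and
`δᵢ ≡ 1 (mod 4)`; `0` if no good suffix exists. -/
noncomputable def mNWp (σ : List Turn) : ℕ :=
  if ∃ k, GoodSuffix σ k then
    Nat.card {i : ℕ // sInf {k | GoodSuffix σ k} - 1 ≤ i ∧ i ≤ σ.length ∧
      delta σ i % 4 = 1}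
  else 0

/-- The number of vertical segments of the chain `C` meeting the closed horizontal
segment from the origin to `(a, 0)`. -/
def verticalCrossCount (σ : List Turn) (C : Chain σ) (a : ℤ) : ℕ :=
  ((Finset.range (σ.length + 1)).filter fun i =>
    (C.pts i).1 = (C.pts (i + 1)).1 ∧
    0 ≤ (C.pts i).1 ∧ (C.pts i).1 ≤ a ∧
    min (C.pts i).2 (C.pts (i + 1)).2 ≤ 0 ∧ 0 ≤ max (C.pts i).2 (C.pts (i + 1)).2).card

/-- The unit direction of the `(i+1)`-st segment of the chain `C`. -/
def dirOf (σ : List Turn) (C : Chain σ) (i : ℕ) : ℤ × ℤ := unitDir (C.pts i) (C.pts (i + 1))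

/-- `z₁mz₂ᵒ(C)`: the number of `z₂`-segments in the maximal `(z₁,z₂)`-staircase subchain
of `C` containing the origin (the longest prefix of segments directed `z₁` or `z₂`);
`0` if no such subchain exists. -/
noncomputable def stairCountO (σ : List Turn) (C : Chain σ) (z₁ z₂ : ℤ × ℤ) : ℕ :=
  Nat.card {i : ℕ // i ≤ σ.length ∧ dirOf σ C i = z₂ ∧
    ∀ j ≤ i, dirOf σ C j = z₁ ∨ dirOf σ C j = z₂}

/-- `z₁mz₂ᵖ(C)`: the number of `z₂`-segments in the maximal `(z₁,z₂)`-staircase subchain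
of `C` containing the endpoint (the longest suffix of segments directed `z₁` or `z₂`);
`0` if no such subchain exists. -/
noncomputable def stairCountP (σ : List Turn) (C : Chain σ) (z₁ z₂ : ℤ × ℤ) : ℕ :=
  Nat.card {i : ℕ // i ≤ σ.length ∧ dirOf σ C i = z₂ ∧
    ∀ j, i ≤ j → j ≤ σ.length → dirOf σ C j = z₁ ∨ dirOf σ C j = z₂}

/-! ### Secant crossings of a rectilinear path -/

/-- The indicator of the nonnegative integers. -/
def nonnegInd (y : ℤ) : ℤ := if 0 ≤ y then 1 else 0

/-- The signed number of times an axis-parallel move of a vector from `d` to `d'` crosses the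
positive `x`-axis, counted when passing between negative and nonnegative ordinates. -/
def rayCross (d d' : ℤ × ℤ) : ℤ := if 0 < d.1 then nonnegInd d'.2 - nonnegInd d.2 else 0

/-- The contribution of the bend `u → v → w` to the number of full turns: `1` for a turn from
`-y` to `+x`, `-1` for a turn from `+x` to `-y`. -/
def bendCross (u v w : ℤ × ℤ) : ℤ := rayCross (v - u) (w - u) + rayCross (w - u) (w - v)

/-- Axis-parallelism of a pair of points. -/
def AxisPar (u v : ℤ × ℤ) : Prop := u.1 = v.1 ∨ u.2 = v.2

theorem rayCross_square {u u' v v' : ℤ × ℤ} (hu : AxisPar u u') (hv : AxisPar v v')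
    (h : segSet u u' ∩ segSet v v' = ∅) :
    rayCross (v' - u) (v' - u') - rayCross (v - u) (v - u') =
      rayCross (v - u') (v' - u') - rayCross (v - u) (v' - u) := by
  have h1 (p : ℤ × ℤ) : ¬ (p ∈ segSet u u' ∧ p ∈ segSet v v') :=
    Set.eq_empty_iff_forall_notMem.1 h p
  have h2 := h1 (v.1, u.2)
  have h3 := h1 (u.1, v.2)
  obtain ⟨a, b⟩ := u
  obtain ⟨a', b'⟩ := u'
  obtain ⟨c, d⟩ := v
  obtain ⟨c', d'⟩ := v'
  simp only [AxisPar, segSet, Set.mem_ofPred_eq, rayCross, nonnegInd, Prod.fst_sub,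
    Prod.snd_sub] at *
  clear h h1
  rcases hu with rfl | rfl <;> rcases hv with rfl | rfl
  · split_ifs <;> omega
  · clear h2
    split_ifs <;> omega
  · clear h3
    split_ifs <;> omega
  · split_ifs <;> omega

theorem sum_Ico_telescope (g : ℕ → ℤ) {m n : ℕ} (h : m ≤ n) :
    ∑ i ∈ Finset.Ico m n, (g (i + 1) - g i) = g n - g m := by
  induction n, h using Nat.le_induction with
  | base => simp
  | succ n hn ih => rw [Finset.sum_Ico_succ_top hn, ih]; ring

theorem rayCross_zero_left (d : ℤ × ℤ) : rayCross 0 d = 0 := by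
  simp [rayCross]

theorem rayCross_zero_right {u v : ℤ × ℤ} (h : AxisPar u v) : rayCross (v - u) 0 = 0 := by
  obtain ⟨a, b⟩ := u
  obtain ⟨c, d⟩ := v
  simp only [AxisPar, rayCross, nonnegInd, Prod.fst_sub, Prod.snd_sub, Prod.snd_zero] at *
  split_ifs <;> omega

/-- Discrete form of Hopf's secant argument: the bends of a simple rectilinear path are counted by
the crossings of secants from its first point plus those of secants to its last point. -/
theorem sum_bendCross (q : ℕ → ℤ × ℤ) (lo h : ℕ) (hlo : lo ≤ h)
    (hax : ∀ i, lo ≤ i → i ≤ h → AxisPar (q i) (q (i + 1)))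
    (hdis : ∀ i j, lo ≤ i → i + 1 < j → j ≤ h →
      segSet (q i) (q (i + 1)) ∩ segSet (q j) (q (j + 1)) = ∅) :
    ∑ i ∈ Finset.Ico lo h, bendCross (q i) (q (i + 1)) (q (i + 2)) =
      ∑ j ∈ Finset.Ico lo (h + 1), rayCross (q j - q lo) (q (j + 1) - q lo) +
      ∑ i ∈ Finset.Ico lo (h + 1), rayCross (q (h + 1) - q i) (q (h + 1) - q (i + 1)) := by
  induction h, hlo using Nat.le_induction with
  | base => simp [rayCross_zero_left, rayCross_zero_right (hax lo le_rfl le_rfl)]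
  | succ h hh ih =>
    have ih' := ih (fun i h1 h2 => hax i h1 (by omega))
      (fun i j h1 h2 h3 => hdis i j h1 h2 (by omega))
    rw [Finset.sum_Ico_succ_top hh, ih']
    rw [Finset.sum_Ico_succ_top (show lo ≤ h + 1 by omega),
      Finset.sum_Ico_succ_top (show lo ≤ h + 1 by omega)]
    rw [Finset.sum_Ico_succ_top hh (fun i => rayCross (q (h + 1) - q i) (q (h + 1) - q (i + 1))),
      Finset.sum_Ico_succ_top hh
        (fun i => rayCross (q (h + 1 + 1) - q i) (q (h + 1 + 1) - q (i + 1)))]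
    simp only [sub_self]
    rw [rayCross_zero_right (hax h hh (by omega)), rayCross_zero_right (hax (h + 1) (by omega) le_rfl)]
    have key : ∑ i ∈ Finset.Ico lo h, rayCross (q (h + 1 + 1) - q i) (q (h + 1 + 1) - q (i + 1)) -
        ∑ i ∈ Finset.Ico lo h, rayCross (q (h + 1) - q i) (q (h + 1) - q (i + 1)) =
        rayCross (q (h + 1) - q h) (q (h + 2) - q h) -
          rayCross (q (h + 1) - q lo) (q (h + 2) - q lo) := by
      rw [← Finset.sum_sub_distrib,
        ← sum_Ico_telescope (fun i => rayCross (q (h + 1) - q i) (q (h + 2) - q i)) hh]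
      apply Finset.sum_congr rfl
      intro i hi
      rw [Finset.mem_Ico] at hi
      exact rayCross_square (hax i hi.1 (by omega)) (hax (h + 1) (by omega) le_rfl)
        (hdis i (h + 1) hi.1 (by omega) le_rfl)
    simp only [bendCross]
    linarith

/-! ### Directed rectilinear paths -/

/-- The unit vector reached from `(1, 0)` after `n` counterclockwise quarter turns. -/
def quarterDir (n : ℤ) : ℤ × ℤ :=
  if n % 4 = 0 then (1, 0) else if n % 4 = 1 then (0, 1)
  else if n % 4 = 2 then (-1, 0) else (0, -1)

theorem unitDir_eq_quarterDir {u v : ℤ × ℤ} {n : ℤ} (h : unitDir u v = quarterDir n) :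
    (n % 4 = 0 ∧ u.1 < v.1 ∧ u.2 = v.2) ∨ (n % 4 = 1 ∧ u.1 = v.1 ∧ u.2 < v.2) ∨
    (n % 4 = 2 ∧ v.1 < u.1 ∧ u.2 = v.2) ∨ (n % 4 = 3 ∧ u.1 = v.1 ∧ v.2 < u.2) := by
  simp only [unitDir, quarterDir] at h
  split_ifs at h with h0 h1 h2 <;>
    simp only [Prod.mk.injEq, Int.sign_eq_one_iff_pos, Int.sign_eq_neg_one_iff_neg,
      Int.sign_eq_zero_iff_zero] at h <;> omega

theorem quarterDir_unitDir_vertical {u v : ℤ × ℤ} {n : ℤ}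
    (h : (n % 4 = 1 ∧ u.1 = v.1 ∧ u.2 < v.2) ∨ (n % 4 = 3 ∧ u.1 = v.1 ∧ v.2 < u.2)) :
    unitDir u v = quarterDir n := by
  rcases h with ⟨h, h1, h2⟩ | ⟨h, h1, h2⟩
  · simp [unitDir, quarterDir, h, h1, Int.sign_eq_one_of_pos (sub_pos.2 h2)]
  · simp [unitDir, quarterDir, h, h1, Int.sign_eq_neg_one_of_neg (sub_neg.2 h2)]

theorem bendCross_eq {u v w : ℤ × ℤ} {m n : ℤ} (h1 : unitDir u v = quarterDir m)
    (h2 : unitDir v w = quarterDir n) (h : n = m + 1 ∨ n = m - 1) :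
    bendCross u v w = n / 4 - m / 4 := by
  have h1 := unitDir_eq_quarterDir h1
  have h2 := unitDir_eq_quarterDir h2
  simp only [bendCross, rayCross, nonnegInd, Prod.fst_sub, Prod.snd_sub]
  rcases h1 with h1 | h1 | h1 | h1 <;> rcases h2 with h2 | h2 | h2 | h2 <;>
    omega

/-- The points `q 0, …, q M` form a simple rectilinear path whose `i`-th segment points in the
direction obtained from `+x` by `D i` counterclockwise quarter turns. -/
structure IsTurnPath (q : ℕ → ℤ × ℤ) (D : ℕ → ℤ) (M : ℕ) : Prop where
  dir : ∀ i < M, unitDir (q i) (q (i + 1)) = quarterDir (D i)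
  step : ∀ i, i + 1 < M → D (i + 1) = D i + 1 ∨ D (i + 1) = D i - 1
  disj : ∀ i j, i + 1 < j → j < M →
    segSet (q i) (q (i + 1)) ∩ segSet (q j) (q (j + 1)) = ∅

theorem IsTurnPath.seg {q : ℕ → ℤ × ℤ} {D : ℕ → ℤ} {M : ℕ} (hq : IsTurnPath q D M) {i : ℕ}
    (hi : i < M) :
    (D i % 4 = 0 ∧ (q i).1 < (q (i + 1)).1 ∧ (q i).2 = (q (i + 1)).2) ∨
    (D i % 4 = 1 ∧ (q i).1 = (q (i + 1)).1 ∧ (q i).2 < (q (i + 1)).2) ∨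
    (D i % 4 = 2 ∧ (q (i + 1)).1 < (q i).1 ∧ (q i).2 = (q (i + 1)).2) ∨
    (D i % 4 = 3 ∧ (q i).1 = (q (i + 1)).1 ∧ (q (i + 1)).2 < (q i).2) :=
  unitDir_eq_quarterDir (hq.dir i hi)

theorem IsTurnPath.axisPar {q : ℕ → ℤ × ℤ} {D : ℕ → ℤ} {M : ℕ} (hq : IsTurnPath q D M) {i : ℕ}
    (hi : i < M) : AxisPar (q i) (q (i + 1)) := by
  have := hq.seg hi
  unfold AxisPar
  omega

theorem IsTurnPath.not_mem_both {q : ℕ → ℤ × ℤ} {D : ℕ → ℤ} {M : ℕ} (hq : IsTurnPath q D M)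
    {i j : ℕ} (hij : i + 1 < j) (hj : j < M) (p : ℤ × ℤ) :
    ¬ (p ∈ segSet (q i) (q (i + 1)) ∧ p ∈ segSet (q j) (q (j + 1))) :=
  Set.eq_empty_iff_forall_notMem.1 (hq.disj i j hij hj) p

theorem IsTurnPath.sum_bendCross_eq {q : ℕ → ℤ × ℤ} {D : ℕ → ℤ} {N : ℕ}
    (hq : IsTurnPath q D (N + 1)) :
    ∑ i ∈ Finset.Ico 0 N, bendCross (q i) (q (i + 1)) (q (i + 2)) = D N / 4 - D 0 / 4 := by
  rw [← sum_Ico_telescope (fun i => D i / 4) (Nat.zero_le N)]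
  apply Finset.sum_congr rfl
  intro i hi
  rw [Finset.mem_Ico] at hi
  exact bendCross_eq (hq.dir i (by omega)) (hq.dir (i + 1) (by omega)) (hq.step i (by omega))

theorem exists_lexMin (q : ℕ → ℤ × ℤ) (M : ℕ) :
    ∃ c ≤ M, ∀ i ≤ M, (q c).2 < (q i).2 ∨ ((q c).2 = (q i).2 ∧ (q c).1 ≤ (q i).1) := by
  obtain ⟨c, hc, hmin⟩ := Finset.exists_min_image (Finset.range (M + 1))
    (fun i => toLex ((q i).2, (q i).1)) ⟨0, by simp⟩
  refine ⟨c, by simpa [Nat.lt_succ_iff] using hc, fun i hi => ?_⟩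
  have := hmin i (by simpa [Nat.lt_succ_iff] using hi)
  simpa [Prod.Lex.le_iff] using this

/-- The number of columns strictly between the endpoints bounds the number of vertical segments
meeting the open horizontal segment between them. -/
theorem IsTurnPath.card_crossing_le {q : ℕ → ℤ × ℤ} {D : ℕ → ℤ} {M : ℕ} (hq : IsTurnPath q D M)
    {x₀ x₁ y : ℤ} (hx : x₀ < x₁) :
    (((Finset.range M).filter fun j => x₀ < (q j).1 ∧ (q j).1 < x₁ ∧ (q j).1 = (q (j + 1)).1 ∧
      min (q j).2 (q (j + 1)).2 ≤ y ∧ y ≤ max (q j).2 (q (j + 1)).2).card : ℤ) ≤ x₁ - x₀ - 1 := by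
  have h := Finset.card_le_card_of_injOn (s := (Finset.range M).filter fun j =>
      x₀ < (q j).1 ∧ (q j).1 < x₁ ∧ (q j).1 = (q (j + 1)).1 ∧
      min (q j).2 (q (j + 1)).2 ≤ y ∧ y ≤ max (q j).2 (q (j + 1)).2) (t := Finset.Ioo x₀ x₁) (fun j => (q j).1) ?_ ?_
  · rw [Int.card_Ioo] at h
    omega
  · intro j hj
    simp only [Finset.coe_filter, Finset.mem_range, Set.mem_ofPred_eq] at hj
    simp [hj.2.1, hj.2.2.1]
  · have key : ∀ j k, j < k → k < M → (q j).1 = (q (j + 1)).1 → (q k).1 = (q (k + 1)).1 →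
        min (q j).2 (q (j + 1)).2 ≤ y ∧ y ≤ max (q j).2 (q (j + 1)).2 →
        min (q k).2 (q (k + 1)).2 ≤ y ∧ y ≤ max (q k).2 (q (k + 1)).2 →
        (q j).1 ≠ (q k).1 := by
      intro j k hjk hk h1 h2 h3 h4 h5
      rcases Nat.lt_or_ge (j + 1) k with h | h
      · have := hq.not_mem_both h hk ((q j).1, y)
        simp only [segSet, Set.mem_ofPred_eq] at this
        omega
      · obtain rfl : k = j + 1 := by omega
        have s1 := hq.seg (i := j) (by omega)
        have s2 := hq.seg hk
        have s3 := hq.step j hk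
        omega
    intro j hj k hk hjk
    simp only [Finset.coe_filter, Finset.mem_range, Set.mem_ofPred_eq] at hj hk
    by_contra hne
    rcases Nat.lt_or_gt_of_ne hne with h | h
    · exact key j k h hk.1 hj.2.2.2.1 hk.2.2.2.1 hj.2.2.2.2 hk.2.2.2.2 hjk
    · exact key k j h hj.1 hk.2.2.2.1 hj.2.2.2.1 hk.2.2.2.2 hj.2.2.2.2 hjk.symm

theorem abs_rayCross_start_le {o e v w : ℤ × ℤ}
    (h : v.1 = w.1 ∨ v.2 = w.2) :
    |if o.1 < v.1 ∧ v.1 < e.1 then rayCross (v - o) (w - o) else 0| ≤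
      if o.1 < v.1 ∧ v.1 < e.1 ∧ v.1 = w.1 ∧ min v.2 w.2 ≤ o.2 ∧ o.2 ≤ max v.2 w.2 then 1
      else 0 := by
  obtain ⟨a, b⟩ := v
  obtain ⟨c, d⟩ := w
  simp only [rayCross, nonnegInd, Prod.fst_sub, Prod.snd_sub] at *
  rcases h with rfl | rfl
  · rw [abs_le]; grind
  · simp; grind

theorem abs_rayCross_end_le {o e v w : ℤ × ℤ} (hy : o.2 = e.2)
    (h : v.1 = w.1 ∨ v.2 = w.2) :
    |if o.1 < v.1 ∧ v.1 < e.1 then rayCross (e - v) (e - w) else 0| ≤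
      if o.1 < v.1 ∧ v.1 < e.1 ∧ v.1 = w.1 ∧ min v.2 w.2 ≤ o.2 ∧ o.2 ≤ max v.2 w.2 then 1
      else 0 := by
  obtain ⟨a, b⟩ := v
  obtain ⟨c, d⟩ := w
  simp only [rayCross, nonnegInd, Prod.fst_sub, Prod.snd_sub] at *
  rcases h with rfl | rfl
  · rw [abs_le]; grind
  · simp; grind

theorem rayCross_sub_eq_of_right {o e v w : ℤ × ℤ} (hy : o.2 = e.2) (hx : o.1 < e.1)
    (h : v.1 = w.1 ∨ v.2 = w.2)
    (hn : ¬ (v.2 = o.2 ∧ w.2 = o.2 ∧ min v.1 w.1 ≤ e.1 ∧ e.1 ≤ max v.1 w.1)) :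
    rayCross (v - o) (w - o) - rayCross (e - v) (e - w) =
      (if o.1 < v.1 ∧ v.1 < e.1 then rayCross (v - o) (w - o) else 0) +
      ((if e.1 ≤ w.1 ∧ w.2 = o.2 then 1 else 0) - nonnegInd (o.2 - w.2) -
        ((if e.1 ≤ v.1 ∧ v.2 = o.2 then 1 else 0) - nonnegInd (o.2 - v.2))) := by
  obtain ⟨a, b⟩ := v
  obtain ⟨c, d⟩ := w
  simp only [rayCross, nonnegInd, Prod.fst_sub, Prod.snd_sub] at *
  rcases h with rfl | rfl <;> grind

theorem rayCross_sub_eq_of_left {o e v w : ℤ × ℤ} (hy : o.2 = e.2) (hx : o.1 < e.1)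
    (h : v.1 = w.1 ∨ v.2 = w.2)
    (hn : ¬ (v.2 = o.2 ∧ w.2 = o.2 ∧ min v.1 w.1 ≤ o.1 ∧ o.1 ≤ max v.1 w.1)) :
    rayCross (e - v) (e - w) - rayCross (v - o) (w - o) =
      (if o.1 < v.1 ∧ v.1 < e.1 then rayCross (e - v) (e - w) else 0) +
      ((if w.1 ≤ o.1 ∧ w.2 = o.2 then 1 else 0) - nonnegInd (w.2 - o.2) -
        ((if v.1 ≤ o.1 ∧ v.2 = o.2 then 1 else 0) - nonnegInd (v.2 - o.2))) := by
  obtain ⟨a, b⟩ := v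
  obtain ⟨c, d⟩ := w
  simp only [rayCross, nonnegInd, Prod.fst_sub, Prod.snd_sub] at *
  rcases h with rfl | rfl <;> grind

/-- The number of full turns of a simple rectilinear path between two points of a horizontal line,
starting vertically and arriving from below at the right one, is determined up to `1` by the
crossings with the open segment between these points. -/
theorem IsTurnPath.turns_eq {q : ℕ → ℤ × ℤ} {D : ℕ → ℤ} {N : ℕ} (hq : IsTurnPath q D (N + 1))
    (hD0 : D 0 % 2 = 1) (hDN : D N % 4 = 1) (hy : (q 0).2 = (q (N + 1)).2)
    (hx : (q 0).1 < (q (N + 1)).1) :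
    ∃ τ B : ℤ, (τ = 0 ∨ τ = 1) ∧ |B| ≤ (q (N + 1)).1 - (q 0).1 - 1 ∧
      D N / 4 - D 0 / 4 = 2 * τ - 1 + B := by
  obtain ⟨c, hcM, hc⟩ := exists_lexMin q (N + 1)
  have segN := hq.seg (i := N) (by omega)
  have seg0 := hq.seg (i := 0) (by omega)
  simp only [zero_add] at seg0
  have hcN : c ≤ N := by
    have h1 := hc N (by omega)
    by_contra h
    obtain rfl : c = N + 1 := by omega
    omega
  have hylt : (q c).2 < (q 0).2 := by
    have h1 := hc N (by omega)
    omega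
  obtain ⟨b, rfl⟩ : ∃ b, c = b + 1 := by
    refine ⟨c - 1, ?_⟩
    rcases Nat.eq_zero_or_pos c with rfl | h
    · omega
    · omega
  have noEnd : ∀ j < N, ¬ ((q j).2 = (q 0).2 ∧ (q (j + 1)).2 = (q 0).2 ∧
      min (q j).1 (q (j + 1)).1 ≤ (q (N + 1)).1 ∧ (q (N + 1)).1 ≤ max (q j).1 (q (j + 1)).1) := by
    intro j hj h
    rcases Nat.lt_or_ge (j + 1) N with h1 | h1
    · have := hq.not_mem_both h1 (by omega) ((q (N + 1)).1, (q 0).2)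
      simp only [segSet, Set.mem_ofPred_eq] at this
      omega
    · obtain rfl : N = j + 1 := by omega
      omega
  have noStart : ∀ j ≤ N, 1 ≤ j → ¬ ((q j).2 = (q 0).2 ∧ (q (j + 1)).2 = (q 0).2 ∧
      min (q j).1 (q (j + 1)).1 ≤ (q 0).1 ∧ (q 0).1 ≤ max (q j).1 (q (j + 1)).1) := by
    intro j hj hj1 h
    rcases Nat.lt_or_ge 1 j with h1 | h1
    · have := hq.not_mem_both (i := 0) (j := j) (by omega) (by omega) ((q 0).1, (q 0).2)
      simp only [segSet, Set.mem_ofPred_eq] at this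
      omega
    · obtain rfl : j = 1 := by omega
      omega
  set U : ℕ → ℤ := fun j => rayCross (q j - q 0) (q (j + 1) - q 0) with hU
  set V : ℕ → ℤ := fun j => rayCross (q (N + 1) - q j) (q (N + 1) - q (j + 1)) with hV
  have hfull := sum_bendCross q 0 N (by omega) (fun i _ hi => hq.axisPar (by omega))
    (fun i j _ h1 h2 => hq.disj i j h1 (by omega))
  rw [hq.sum_bendCross_eq] at hfull
  have hsplit : ∑ i ∈ Finset.Ico 0 N, bendCross (q i) (q (i + 1)) (q (i + 2)) =
      ∑ i ∈ Finset.Ico 0 b, bendCross (q i) (q (i + 1)) (q (i + 2)) +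
      bendCross (q b) (q (b + 1)) (q (b + 2)) +
      ∑ i ∈ Finset.Ico (b + 1) N, bendCross (q i) (q (i + 1)) (q (i + 2)) := by
    rw [← Finset.sum_Ico_succ_top (Nat.zero_le b),
      Finset.sum_Ico_consecutive _ (Nat.zero_le _) hcN]
  rw [hq.sum_bendCross_eq] at hsplit
  rw [sum_bendCross q 0 b (by omega) (fun i _ hi => hq.axisPar (by omega))
    (fun i j _ h1 h2 => hq.disj i j h1 (by omega)),
    sum_bendCross q (b + 1) N (by omega) (fun i _ hi => hq.axisPar (by omega))
    (fun i j _ h1 h2 => hq.disj i j h1 (by omega))] at hsplit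
  have hz1 : ∑ i ∈ Finset.Ico 0 (b + 1),
      rayCross (q (b + 1) - q i) (q (b + 1) - q (i + 1)) = 0 := by
    apply Finset.sum_eq_zero
    intro i hi
    rw [Finset.mem_Ico] at hi
    have s := hq.seg (i := i) (by omega)
    have m1 := hc i (by omega)
    have m2 := hc (i + 1) (by omega)
    simp only [rayCross, nonnegInd, Prod.fst_sub, Prod.snd_sub]
    split_ifs <;> omega
  have hz2 : ∑ j ∈ Finset.Ico (b + 1) (N + 1),
      rayCross (q j - q (b + 1)) (q (j + 1) - q (b + 1)) = 0 := by
    apply Finset.sum_eq_zero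
    intro i hi
    rw [Finset.mem_Ico] at hi
    have m1 := hc i (by omega)
    have m2 := hc (i + 1) (by omega)
    simp only [rayCross, nonnegInd, Prod.fst_sub, Prod.snd_sub]
    split_ifs <;> omega
  rw [hz1, hz2] at hsplit
  have hτ : bendCross (q b) (q (b + 1)) (q (b + 2)) = 0 ∨
      bendCross (q b) (q (b + 1)) (q (b + 2)) = 1 := by
    have s1 := hq.seg (i := b) (by omega)
    have s2 := hq.seg (i := b + 1) (by omega)
    have s3 := hq.step b (by omega)
    have m1 := hc b (by omega)
    have m2 := hc (b + 2) (by omega)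
    rw [bendCross_eq (hq.dir b (by omega)) (hq.dir (b + 1) (by omega)) s3]
    simp only [add_assoc, Nat.reduceAdd] at *
    omega
  rw [← Finset.sum_Ico_consecutive _ (Nat.zero_le (b + 1)) (show b + 1 ≤ N + 1 by omega),
    ← Finset.sum_Ico_consecutive _ (Nat.zero_le (b + 1)) (show b + 1 ≤ N + 1 by omega)] at hfull
  set P : ℕ → Prop := fun j => (q 0).1 < (q j).1 ∧ (q j).1 < (q (N + 1)).1 with hP
  set B₁ : ℕ → ℤ := fun j => if P j then U j else 0 with hB₁
  set B₂ : ℕ → ℤ := fun j => if P j then V j else 0 with hB₂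
  set F₁ : ℕ → ℤ := fun j => (if (q (N + 1)).1 ≤ (q j).1 ∧ (q j).2 = (q 0).2 then 1 else 0) -
    nonnegInd ((q 0).2 - (q j).2) with hF₁
  set F₂ : ℕ → ℤ := fun j => (if (q j).1 ≤ (q 0).1 ∧ (q j).2 = (q 0).2 then 1 else 0) -
    nonnegInd ((q j).2 - (q 0).2) with hF₂
  have e1 : ∑ j ∈ Finset.Ico 0 (b + 1), U j - ∑ j ∈ Finset.Ico 0 (b + 1), V j =
      ∑ j ∈ Finset.Ico 0 (b + 1), B₁ j := by
    have h0 : F₁ (b + 1) - F₁ 0 = 0 := by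
      simp only [hF₁, nonnegInd]
      split_ifs <;> omega
    rw [← sum_Ico_telescope F₁ (Nat.zero_le _)] at h0
    rw [← add_zero (∑ j ∈ Finset.Ico 0 (b + 1), B₁ j), ← h0, ← Finset.sum_sub_distrib,
      ← Finset.sum_add_distrib]
    apply Finset.sum_congr rfl
    intro j hj
    rw [Finset.mem_Ico] at hj
    have s := hq.seg (i := j) (by omega)
    have n := noEnd j (by omega)
    simp only [hB₁, hF₁, hU, hV, hP]
    exact rayCross_sub_eq_of_right hy hx (by omega) n
  have e2 : ∑ j ∈ Finset.Ico (b + 1) (N + 1), V j - ∑ j ∈ Finset.Ico (b + 1) (N + 1), U j =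
      ∑ j ∈ Finset.Ico (b + 1) (N + 1), B₂ j - 1 := by
    have h0 : F₂ (N + 1) - F₂ (b + 1) = -1 := by
      simp only [hF₂, nonnegInd]
      split_ifs <;> omega
    rw [← sum_Ico_telescope F₂ (by omega)] at h0
    rw [sub_eq_add_neg _ (1 : ℤ), ← h0, ← Finset.sum_sub_distrib,
      ← Finset.sum_add_distrib]
    apply Finset.sum_congr rfl
    intro j hj
    rw [Finset.mem_Ico] at hj
    have s := hq.seg (i := j) (by omega)
    have n := noStart j (by omega) (by omega)
    simp only [hB₂, hF₂, hU, hV, hP]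
    exact rayCross_sub_eq_of_left hy hx (by omega) n
  refine ⟨bendCross (q b) (q (b + 1)) (q (b + 2)),
    ∑ j ∈ Finset.Ico 0 (b + 1), B₁ j + ∑ j ∈ Finset.Ico (b + 1) (N + 1), B₂ j, hτ, ?_, ?_⟩
  · refine le_trans ?_ (hq.card_crossing_le (y := (q 0).2) hx)
    rw [Finset.card_filter]
    push_cast
    rw [Finset.range_eq_Ico, ← Finset.sum_Ico_consecutive _ (Nat.zero_le (b + 1))
      (show b + 1 ≤ N + 1 by omega)]
    refine (abs_add_le _ _).trans (add_le_add ?_ ?_) <;>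
      refine (Finset.abs_sum_le_sum_abs _ _).trans (Finset.sum_le_sum fun j hj => ?_)
    all_goals
      rw [Finset.mem_Ico] at hj
      have s := hq.seg (i := j) (by omega)
    · exact abs_rayCross_start_le (by omega)
    · exact abs_rayCross_end_le hy (by omega)
  · linarith

theorem segSet_subset {u v a b : ℤ × ℤ} (ha : a ∈ segSet u v) (hb : b ∈ segSet u v) :
    segSet a b ⊆ segSet u v := by
  intro p hp
  simp only [segSet, Set.mem_ofPred_eq] at *
  omega

theorem left_mem_segSet (u v : ℤ × ℤ) : u ∈ segSet u v := by
  simp [segSet]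

theorem right_mem_segSet (u v : ℤ × ℤ) : v ∈ segSet u v := by
  simp [segSet]

/-- Cutting a path in the interior of two of its segments. -/
theorem IsTurnPath.truncate {q : ℕ → ℤ × ℤ} {D : ℕ → ℤ} {M : ℕ} (hq : IsTurnPath q D M)
    {e g : ℕ} (hg : 0 < g) (hM : e + g < M) {a b : ℤ × ℤ}
    (ha : a ∈ segSet (q e) (q (e + 1))) (hb : b ∈ segSet (q (e + g)) (q (e + g + 1)))
    (hda : unitDir a (q (e + 1)) = quarterDir (D e))
    (hdb : unitDir (q (e + g)) b = quarterDir (D (e + g))) :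
    IsTurnPath (fun j => if j = 0 then a else if j = g + 1 then b else q (e + j))
      (fun j => D (e + j)) (g + 1) where
  dir i hi := by
    rcases Nat.eq_zero_or_pos i with rfl | h0
    · simpa [hg.ne, hg.ne'] using hda
    · rcases Nat.lt_or_ge i g with h | h
      · simpa [h0.ne', h.ne, hi.ne, ← add_assoc] using hq.dir (e + i) (by omega)
      · obtain rfl : i = g := by omega
        simpa [h0.ne'] using hdb
  step i hi := hq.step (e + i) (by omega)
  disj i j hij hj := by
    have key : ∀ k < g + 1, segSet (if k = 0 then a else if k = g + 1 then b else q (e + k))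
        (if k + 1 = 0 then a else if k + 1 = g + 1 then b else q (e + (k + 1))) ⊆
        segSet (q (e + k)) (q (e + k + 1)) := by
      intro k hk
      apply segSet_subset
      · split_ifs with h1 h2
        · simpa [h1] using ha
        · omega
        · exact left_mem_segSet _ _
      · rw [if_neg (Nat.succ_ne_zero k)]
        split_ifs with h1
        · obtain rfl : k = g := by omega
          exact hb
        · exact right_mem_segSet _ _
    have := hq.disj (e + i) (e + j) (by omega) (by omega)
    rw [← Set.subset_empty_iff] at this ⊢
    exact (Set.inter_subset_inter (key i (by omega)) (key j hj)).trans this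

/-- The turns between two vertical segments meeting a common horizontal line, the right one being
directed upwards, are controlled by the distance of these segments. -/
theorem IsTurnPath.turns_eq_between {q : ℕ → ℤ × ℤ} {D : ℕ → ℤ} {M : ℕ} (hq : IsTurnPath q D M)
    {e f : ℕ} (hef : e < f) (hf : f < M) (he : D e % 2 = 1) (hDf : D f % 4 = 1) {y : ℤ}
    (hye : min (q e).2 (q (e + 1)).2 ≤ y) (hye' : y ≤ max (q e).2 (q (e + 1)).2)
    (hne : y ≠ (q (e + 1)).2) (hyf : (q f).2 < y) (hyf' : y ≤ (q (f + 1)).2)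
    (hx : (q e).1 < (q f).1) :
    ∃ τ B : ℤ, (τ = 0 ∨ τ = 1) ∧ |B| ≤ (q f).1 - (q e).1 - 1 ∧
      D f / 4 - D e / 4 = 2 * τ - 1 + B := by
  obtain ⟨g, rfl⟩ := Nat.exists_eq_add_of_lt hef
  have se := hq.seg (i := e) (by omega)
  have sf := hq.seg hf
  have ht := hq.truncate (e := e) (g := g + 1) (a := ((q e).1, y))
    (b := ((q (e + g + 1)).1, y)) (by omega) hf
    (by simp only [segSet, Set.mem_ofPred_eq]; omega)
    (by simp only [segSet, Set.mem_ofPred_eq, ← add_assoc]; omega)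
    (quarterDir_unitDir_vertical (by dsimp only; omega))
    (quarterDir_unitDir_vertical (Or.inl ⟨hDf, rfl, hyf⟩))
  simpa [← add_assoc] using ht.turns_eq (by simpa using he) (by simpa [← add_assoc] using hDf)
    (by simp) (by simpa using hx)

theorem IsTurnPath.east_seg {q : ℕ → ℤ × ℤ} {D : ℕ → ℤ} {M : ℕ} (hq : IsTurnPath q D M) {i : ℕ}
    (hi : i < M) (h : D i % 4 = 0) : (q i).1 < (q (i + 1)).1 ∧ (q i).2 = (q (i + 1)).2 := by
  have := hq.seg hi
  omega

theorem IsTurnPath.north_seg {q : ℕ → ℤ × ℤ} {D : ℕ → ℤ} {M : ℕ} (hq : IsTurnPath q D M) {i : ℕ}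
    (hi : i < M) (h : D i % 4 = 1) : (q i).1 = (q (i + 1)).1 ∧ (q i).2 < (q (i + 1)).2 := by
  have := hq.seg hi
  omega

theorem IsTurnPath.south_seg {q : ℕ → ℤ × ℤ} {D : ℕ → ℤ} {M : ℕ} (hq : IsTurnPath q D M) {i : ℕ}
    (hi : i < M) (h : D i % 4 = 3) : (q i).1 = (q (i + 1)).1 ∧ (q (i + 1)).2 < (q i).2 := by
  have := hq.seg hi
  omega

/-! ### Staircases at the two ends of a path -/

/-- The initial part of the path up to segment `e` is directed east or south, and segment `e` is
directed south. -/
def SouthStep (D : ℕ → ℤ) (e : ℕ) : Prop :=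
  D e % 4 = 3 ∧ ∀ j ≤ e, D j % 4 = 0 ∨ D j % 4 = 3

/-- The final part of the path from segment `f` to segment `n` is directed east or north, and
segment `f` is directed north. -/
def NorthStep (D : ℕ → ℤ) (n f : ℕ) : Prop :=
  D f % 4 = 1 ∧ ∀ j, f ≤ j → j ≤ n → D j % 4 = 0 ∨ D j % 4 = 1

/-- The `i`-th south step from the beginning and the `j`-th north step from the end (counting
from `0`) meet the horizontal line at height `y`, in this order. -/
structure FacingSteps (q : ℕ → ℤ × ℤ) (D : ℕ → ℤ) (n : ℕ) (a : ℤ) (i j f : ℕ) (y : ℤ) :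
    Prop where
  south : SouthStep D (2 * i + 1)
  north : NorthStep D n f
  index : f + 2 * j = n
  south_x : (i : ℤ) + 1 ≤ (q (2 * i + 1)).1
  north_x : (q f).1 ≤ a - j
  south_top : y ≤ (q (2 * i + 1)).2
  south_bot : (q (2 * i + 2)).2 < y
  north_bot : (q f).2 < y
  north_top : y ≤ (q (f + 1)).2
  lt : (q (2 * i + 1)).1 < (q f).1

theorem SouthStep.lt_northStep {D : ℕ → ℤ} {n e f : ℕ} (he : SouthStep D e)
    (hf : NorthStep D n f) : e < f := by
  by_contra h
  have h1 := he.2 f (by omega)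
  have h2 := hf.1
  omega

theorem IsTurnPath.exists_facingSteps_last {q : ℕ → ℤ × ℤ} {D : ℕ → ℤ} {n : ℕ}
    (hq : IsTurnPath q D (n + 1)) {a : ℤ} (d : ℕ) :
    ∀ {i j f : ℕ} {y : ℤ}, FacingSteps q D n a i j f y → f - (2 * i + 1) ≤ d →
      ∃ i j f y, FacingSteps q D n a i j f y ∧
        (¬ SouthStep D (2 * i + 3) ∨ ¬ NorthStep D n (f - 2)) := by
  induction d with
  | zero =>
    intro i j f y h hd
    have := h.south.lt_northStep h.north
    omega
  | succ d ih =>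
    intro i j f y h hd
    by_cases hfin : ¬ SouthStep D (2 * i + 3) ∨ ¬ NorthStep D n (f - 2)
    · exact ⟨i, j, f, y, h, hfin⟩
    push Not at hfin
    obtain ⟨hS, hN⟩ := hfin
    have l1 := hS.lt_northStep hN
    obtain ⟨f, rfl⟩ : ∃ g, f = g + 2 := ⟨f - 2, by omega⟩
    rw [Nat.add_sub_cancel] at hN l1
    obtain ⟨south, north, index, south_x, north_x, south_top, south_bot, north_bot, north_top,
      lt⟩ := h
    have e1 := hq.south_seg (by omega) south.1
    have e2 := hq.east_seg (i := 2 * i + 2) (by omega) (by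
      have := hq.step (2 * i + 1) (by omega)
      have := hS.2 (2 * i + 2) (by omega)
      have := south.1
      simp only [add_assoc, Nat.reduceAdd] at *
      omega)
    have e3 := hq.south_seg (by omega) hS.1
    have f1 := hq.north_seg (by omega) north.1
    have f2 := hq.east_seg (i := f + 1) (by omega) (by
      have := hq.step f (by omega)
      have := hN.2 (f + 1) (by omega) (by omega)
      have := hN.1
      omega)
    have f3 := hq.north_seg (by omega) hN.1
    have cS := hq.not_mem_both (i := 2 * i + 2) (j := f + 2) (by omega) (by omega)
      ((q (f + 2)).1, (q (2 * i + 2)).2)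
    have cN := hq.not_mem_both (i := 2 * i + 1) (j := f + 1) (by omega) (by omega)
      ((q (2 * i + 1)).1, (q (f + 1)).2)
    have cB := hq.not_mem_both (i := 2 * i + 2) (j := f + 1) (by omega) (by omega)
      (max (q (2 * i + 2)).1 (q (f + 1)).1, (q (f + 1)).2)
    simp only [segSet, Set.mem_ofPred_eq, add_assoc, Nat.reduceAdd] at *
    rcases lt_trichotomy (q (2 * i + 2)).2 (q (f + 2)).2 with hlt | heq | hgt
    · refine ih (i := i) (j := j + 1) (f := f) (y := (q (f + 2)).2) ⟨south, hN, ?_, ?_, ?_, ?_,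
        ?_, ?_, ?_, ?_⟩ ?_ <;> (try push_cast) <;> omega
    · refine ih (i := i + 1) (j := j + 1) (f := f) (y := (q (f + 2)).2) ⟨hS, hN, ?_, ?_, ?_, ?_,
        ?_, ?_, ?_, ?_⟩ ?_ <;> (try simp only [Nat.mul_add, add_assoc, Nat.reduceAdd,
          Nat.reduceMul]) <;> (try push_cast) <;> omega
    · refine ih (i := i + 1) (j := j) (f := f + 2) (y := (q (2 * i + 2)).2) ⟨hS, north, ?_, ?_,
        ?_, ?_, ?_, ?_, ?_, ?_⟩ ?_ <;> (try simp only [Nat.mul_add, add_assoc, Nat.reduceAdd,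
          Nat.reduceMul]) <;> (try push_cast) <;> omega

theorem IsTurnPath.emod_two {q : ℕ → ℤ × ℤ} {D : ℕ → ℤ} {M : ℕ} (hq : IsTurnPath q D M)
    (hD0 : D 0 = 0) {k : ℕ} (hk : k < M) : D k % 2 = (k : ℤ) % 2 := by
  induction k with
  | zero => simp [hD0]
  | succ k ih =>
    have h1 := ih (by omega)
    have h2 := hq.step k hk
    push_cast
    omega

theorem IsTurnPath.card_southStep_le {q : ℕ → ℤ × ℤ} {D : ℕ → ℤ} {n : ℕ}
    (hq : IsTurnPath q D (n + 1)) (hD0 : D 0 = 0) {i : ℕ} (hi : ¬ SouthStep D (2 * i + 3)) :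
    Nat.card {k : ℕ // k ≤ n ∧ SouthStep D k} ≤ i + 1 := by
  have hsub : {k : ℕ | k ≤ n ∧ SouthStep D k} ⊆
      ((Finset.range (i + 1)).image fun t => 2 * t + 1 : Finset ℕ) := by
    rintro k ⟨hk, hS⟩
    have hk2 := hq.emod_two hD0 (k := k) (by omega)
    have hk3 := hS.1
    simp only [Finset.coe_image, Finset.coe_range, Set.mem_image, Set.mem_Iio]
    refine ⟨k / 2, ?_, by omega⟩
    by_contra h
    refine hi ⟨?_, fun j hj => hS.2 j (by omega)⟩
    have h1 := hq.emod_two hD0 (k := 2 * i + 3) (by omega)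
    have h2 := hS.2 (2 * i + 3) (by omega)
    push_cast at h1
    omega
  have h := Set.ncard_le_ncard hsub (Finset.finite_toSet _)
  rw [Set.ncard_coe_finset] at h
  exact h.trans (Finset.card_image_le.trans (by simp))

theorem IsTurnPath.card_northStep_le {q : ℕ → ℤ × ℤ} {D : ℕ → ℤ} {n : ℕ}
    (hq : IsTurnPath q D (n + 1)) (hD0 : D 0 = 0) {j f : ℕ} (hf : f + 2 * j = n)
    (hn : n % 2 = 1) (hf2 : 2 ≤ f) (hN : ¬ NorthStep D n (f - 2)) :
    Nat.card {k : ℕ // k ≤ n ∧ NorthStep D n k} ≤ j + 1 := by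
  have hsub : {k : ℕ | k ≤ n ∧ NorthStep D n k} ⊆
      ((Finset.range (j + 1)).image fun t => f + 2 * t : Finset ℕ) := by
    rintro k ⟨hk, hS⟩
    have hk2 := hq.emod_two hD0 (k := k) (by omega)
    have hk3 := hS.1
    simp only [Finset.coe_image, Finset.coe_range, Set.mem_image, Set.mem_Iio]
    have hfk : f ≤ k := by
      by_contra h
      refine hN ⟨?_, fun j hj hj' => hS.2 j (by omega) hj'⟩
      have h1 := hq.emod_two hD0 (k := f - 2) (by omega)
      have h2 := hS.2 (f - 2) (by omega) (by omega)
      omega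
    exact ⟨(k - f) / 2, by omega, by omega⟩
  have h := Set.ncard_le_ncard hsub (Finset.finite_toSet _)
  rw [Set.ncard_coe_finset] at h
  exact h.trans (Finset.card_image_le.trans (by simp))

/-! ### Chains as directed paths -/

theorem delta_zero (σ : List Turn) : delta σ 0 = 0 := by
  simp [delta]

theorem delta_length (σ : List Turn) : delta σ σ.length = excess σ := by
  simp [delta, excess]

theorem delta_succ (σ : List Turn) {i : ℕ} (h : i < σ.length) :
    delta σ (i + 1) = delta σ i + if σ.get ⟨i, h⟩ = Turn.L then 1 else -1 := by
  have ht : σ.take (i + 1) = σ.take i ++ [σ.get ⟨i, h⟩] := by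
    simp
  rw [delta, delta, ht, List.count_append, List.count_append]
  cases σ.get ⟨i, h⟩ <;> simp <;> ring

theorem rotCCW_quarterDir (n : ℤ) : rotCCW (quarterDir n) = quarterDir (n + 1) := by
  have h : n % 4 = 0 ∧ (n + 1) % 4 = 1 ∨ n % 4 = 1 ∧ (n + 1) % 4 = 2 ∨
    n % 4 = 2 ∧ (n + 1) % 4 = 3 ∨ n % 4 = 3 ∧ (n + 1) % 4 = 0 := by omega
  rcases h with h | h | h | h <;> simp [rotCCW, quarterDir, h.1, h.2]

theorem rotCW_quarterDir (n : ℤ) : rotCW (quarterDir n) = quarterDir (n + -1) := by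
  have h : n % 4 = 0 ∧ (n + -1) % 4 = 3 ∨ n % 4 = 1 ∧ (n + -1) % 4 = 0 ∨
    n % 4 = 2 ∧ (n + -1) % 4 = 1 ∨ n % 4 = 3 ∧ (n + -1) % 4 = 2 := by omega
  rcases h with h | h | h | h <;> simp [rotCW, quarterDir, h.1, h.2]

theorem Chain.dirOf_eq {σ : List Turn} (C : Chain σ) {i : ℕ} (hi : i ≤ σ.length) :
    dirOf σ C i = quarterDir (delta σ i) := by
  induction i with
  | zero =>
    obtain ⟨t, ht, h1⟩ := C.first_seg
    simp [dirOf, unitDir, C.start_eq, h1, delta_zero, quarterDir, Int.sign_eq_one_of_pos ht]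
  | succ i ih =>
    have h := C.turns i hi
    have ih := ih (by omega)
    rw [dirOf] at ih ⊢
    rw [h, ih, delta_succ σ hi]
    split_ifs
    · exact rotCCW_quarterDir _
    · exact rotCW_quarterDir _

theorem Chain.isTurnPath {σ : List Turn} (C : Chain σ) :
    IsTurnPath C.pts (delta σ) (σ.length + 1) where
  dir i hi := C.dirOf_eq (by omega)
  step i hi := by
    rw [delta_succ σ (show i < σ.length by omega)]
    split_ifs <;> omega
  disj i j hij hj := C.simple_nonadj i j hij (by omega)

theorem quarterDir_eq_east {n : ℤ} : quarterDir n = (1, 0) ↔ n % 4 = 0 := by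
  unfold quarterDir
  split_ifs <;> simp <;> omega

theorem quarterDir_eq_north {n : ℤ} : quarterDir n = (0, 1) ↔ n % 4 = 1 := by
  unfold quarterDir
  split_ifs <;> simp <;> omega

theorem quarterDir_eq_south {n : ℤ} : quarterDir n = (0, -1) ↔ n % 4 = 3 := by
  unfold quarterDir
  split_ifs <;> simp <;> omega

theorem Chain.stairCountO_eq {σ : List Turn} (C : Chain σ) :
    stairCountO σ C (1, 0) (0, -1) =
      Nat.card {k : ℕ // k ≤ σ.length ∧ SouthStep (delta σ) k} := by
  refine Nat.card_congr (Equiv.subtypeEquivRight fun k => and_congr_right fun hk => ?_)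
  rw [C.dirOf_eq hk, quarterDir_eq_south]
  refine and_congr_right fun _ => forall₂_congr fun j hj => ?_
  rw [C.dirOf_eq (hj.trans hk), quarterDir_eq_south, quarterDir_eq_east]

theorem Chain.stairCountP_eq {σ : List Turn} (C : Chain σ) :
    stairCountP σ C (1, 0) (0, 1) =
      Nat.card {k : ℕ // k ≤ σ.length ∧ NorthStep (delta σ) σ.length k} := by
  refine Nat.card_congr (Equiv.subtypeEquivRight fun k => and_congr_right fun hk => ?_)
  rw [C.dirOf_eq hk, quarterDir_eq_north]
  refine and_congr_right fun _ => forall₃_congr fun j _ hj => ?_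
  rw [C.dirOf_eq hj, quarterDir_eq_north, quarterDir_eq_east]

/-- **Lower bound on the closest reachable point on the `+x`-axis when
`l - r ≡ 1 (mod 4)`.** Here `stairCountO σ C (1,0) (0,-1)` is `₊ₓm₋ᵧᵒ(C)` and
`stairCountP σ C (1,0) (0,1)` is `₊ₓm₊ᵧᵖ(C)`. -/
theorem lower_bound_x_plus_mod_one (σ : List Turn) (h0 : 0 ≤ excess σ)
    (h1 : excess σ % 4 = 1) (C : Chain σ) (a : ℤ) (ha : 0 < a)
    (hend : C.pts (σ.length + 1) = (a, 0)) :
    (σ.head? = some Turn.L → |(excess σ + 2) / 4 - 1| + 2 ≤ a) ∧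
    (σ.head? = some Turn.R →
      ((min (stairCountO σ C (1, 0) (0, -1)) (stairCountP σ C (1, 0) (0, 1)) : ℕ) : ℤ) +
        (excess σ + 2) / 4 + 1 ≤ a) := by
  have hq := C.isTurnPath
  have hDn := delta_length σ
  have hD0 := delta_zero σ
  set n := σ.length with hn
  obtain ⟨t, ht, hp1⟩ := C.first_seg
  have hp0 := C.start_eq
  have hn1 : n % 2 = 1 := by
    have := hq.emod_two hD0 (k := n) (by omega)
    omega
  have segn := hq.seg (i := n) (by omega)
  have seg1 := hq.seg (i := 1) (by omega)
  have hn3 : 3 ≤ n := by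
    by_contra h
    have : n = 1 := by omega
    rw [this] at hend segn hDn
    rw [hend, hp1] at segn
    dsimp only at segn
    omega
  have hnm := hq.not_mem_both (i := 0) (j := n) (by omega) (by omega) (a, 0)
  have hD1 : delta σ 1 = 1 ∨ delta σ 1 = -1 := by
    have := hq.step 0 (by omega)
    simp only [zero_add] at this
    omega
  simp only [segSet, Set.mem_ofPred_eq, zero_add, hp0, hp1, hend] at hnm segn
  have hta : t < a := by omega
  have hxn : (C.pts n).1 = a := by omega
  have htail : ∀ T, σ.head? = some T → delta σ 1 = if T = Turn.L then 1 else -1 := by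
    intro T hT
    rw [delta_succ σ (show 0 < σ.length by omega), hD0, List.head?_eq_getElem?] at *
    rw [List.getElem?_eq_some_iff] at hT
    obtain ⟨_, rfl⟩ := hT
    simp
  refine ⟨fun hL => ?_, fun hR => ?_⟩
  · have h1L := htail _ hL
    rw [if_pos rfl] at h1L
    obtain ⟨τ, B, hτ, hB, hk⟩ := hq.turns_eq_between (e := 1) (f := n) (y := 0) (by omega)
      (by omega) (by omega) (by omega) (by rw [hp1]; simp) (by rw [hp1]; simp)
      (by rw [hp1] at seg1; simp only [Nat.reduceAdd] at *; omega) (by omega) (by rw [hend])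
      (by rw [hp1, hxn]; exact hta)
    rw [hxn, hp1] at hB
    rw [abs_le] at hB
    dsimp only at hB
    have : |(excess σ + 2) / 4 - 1| ≤ a - 2 := by
      rw [abs_le]
      omega
    linarith
  · have h1R := htail _ hR
    rw [if_neg (by decide)] at h1R
    have hstart : FacingSteps C.pts (delta σ) n a 0 0 n 0 := by
      rw [hp1] at seg1
      refine ⟨⟨by simp only [mul_zero, zero_add]; omega, fun j hj => ?_⟩,
        ⟨by omega, fun j hj hj' => ?_⟩, by omega, ?_, ?_, ?_, ?_, ?_, ?_, ?_⟩
      · have : j = 0 ∨ j = 1 := by omega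
        rcases this with rfl | rfl <;> omega
      · obtain rfl : j = n := by omega
        omega
      all_goals simp only [mul_zero, zero_add, hp1, hend, Nat.cast_zero, Nat.reduceAdd] at *
      all_goals omega
    obtain ⟨i, j, f, y, h, hfin⟩ := hq.exists_facingSteps_last _ hstart le_rfl
    have hlt := h.south.lt_northStep h.north
    have hidx := h.index
    have hS := h.south.1
    have hN := h.north.1
    have hphi : delta σ f / 4 - delta σ (2 * i + 1) / 4 = excess σ / 4 + 1 := by
      have south_const : ∀ k ≤ 2 * i + 1, delta σ k = 0 ∨ delta σ k = -1 := by
        intro k hk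
        induction k with
        | zero => omega
        | succ k ih =>
          have s1 := ih (by omega)
          have s2 := hq.step k (by omega)
          have s3 := h.south.2 (k + 1) hk
          omega
      have north_const : ∀ k ≤ n - f, delta σ (f + k) / 4 = delta σ f / 4 := by
        intro k hk
        induction k with
        | zero => simp
        | succ k ih =>
          have s1 := ih (by omega)
          have s2 := hq.step (f + k) (by omega)
          have s3 := h.north.2 (f + k) (by omega) (by omega)
          have s4 := h.north.2 (f + (k + 1)) (by omega) (by omega)
          simp only [← add_assoc] at *
          omega
      have s1 := south_const (2 * i + 1) le_rfl
      have s2 := north_const (n - f) le_rfl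
      rw [Nat.add_sub_cancel' (by omega : f ≤ n)] at s2
      omega
    obtain ⟨τ, B, hτ, hB, hk⟩ := hq.turns_eq_between (e := 2 * i + 1) (f := f) (y := y) hlt
      (by omega) (by omega) (by omega)
      (by have := h.south_bot; simp only [add_assoc, Nat.reduceAdd] at *; omega)
      (by have := h.south_top; omega)
      (by have := h.south_bot; simp only [add_assoc, Nat.reduceAdd] at *; omega)
      h.north_bot h.north_top h.lt
    rw [abs_le] at hB
    have hsx := h.south_x
    have hnx := h.north_x
    have hmin : min (stairCountO σ C (1, 0) (0, -1)) (stairCountP σ C (1, 0) (0, 1)) ≤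
        i + j + 1 := by
      rw [C.stairCountO_eq, C.stairCountP_eq]
      rcases hfin with hfin | hfin
      · exact (min_le_left _ _).trans ((hq.card_southStep_le hD0 hfin).trans (by omega))
      · exact (min_le_right _ _).trans
          ((hq.card_northStep_le hD0 hidx hn1 (by omega) hfin).trans (by omega))
    omega
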